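/- arXiv:1911.11810 — 3 statements merged into one kernel-verified Lean document; each statement's English description precedes it below -/
import Mathlib

section
/- Let D ⊆ ℝ^d be a bounded open set and 𝔥 : D → ℝ a bounded Borel measurable function. Let M and M̃ be random Borel measures on D that are almost surely finite, defined on a probability space (Ω, P), and let Y be a standard Gaussian random variable on the same space that is independent of M and independent of M̃. If the random measure ω ↦ (M_ω).withDensity(x ↦ exp(𝔥(x)·Y(ω))) is equal in law to the random measure ω ↦ (M̃_ω).withDensity(x ↦ exp(𝔥(x)·Y(ω))), then M is equal in law to M̃. -/
open MeasureTheory ProbabilityTheory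

open scoped ENNReal NNReal BoundedContinuousFunction

/-- Two bounded continuous functions with the same Gaussian smoothing coincide. -/
lemma eq_of_lintegral_gaussianReal_add_eq {a b : ℝ → ℝ≥0∞} (ha : Continuous a)
    (hb : Continuous b) {K : ℝ≥0} (haK : ∀ y, a y ≤ K) (hbK : ∀ y, b y ≤ K)
    (hab : ∀ s, ∫⁻ y, a (s + y) ∂gaussianReal 0 1 = ∫⁻ y, b (s + y) ∂gaussianReal 0 1) :
    a = b := by
  have shift (c : ℝ → ℝ≥0∞) (hc : Measurable c) (s : ℝ) :
      ∫⁻ y, c (s + y) ∂gaussianReal 0 1 =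
        ENNReal.ofReal (Real.exp (-s ^ 2 / 2)) *
          ∫⁻ y, ENNReal.ofReal (Real.exp (s * y)) ∂(gaussianReal 0 1).withDensity c := by
    have hmap : (gaussianReal 0 1).map (s + ·) = gaussianReal s 1 := by
      simpa using gaussianReal_map_const_add (μ := 0) (v := 1) s
    rw [← lintegral_map (f := c) hc (measurable_const_add s), hmap,
      lintegral_withDensity_eq_lintegral_mul _ hc (by fun_prop),
      gaussianReal_of_var_ne_zero _ one_ne_zero, gaussianReal_of_var_ne_zero _ one_ne_zero,
      lintegral_withDensity_eq_lintegral_mul _ (by fun_prop) hc,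
      lintegral_withDensity_eq_lintegral_mul _ (by fun_prop) (by fun_prop),
      ← lintegral_const_mul _ (by fun_prop)]
    congr 1 with y
    have hpdf : gaussianPDF s 1 y = ENNReal.ofReal (Real.exp (-s ^ 2 / 2)) *
        (gaussianPDF 0 1 y * ENNReal.ofReal (Real.exp (s * y))) := by
      rw [gaussianPDF, gaussianPDF, ← ENNReal.ofReal_mul (gaussianPDFReal_nonneg _ _ _),
        ← ENNReal.ofReal_mul (Real.exp_nonneg _), gaussianPDFReal, gaussianPDFReal]
      have hquad : Real.exp (-(y - s) ^ 2 / (2 * (1 : ℝ≥0))) = Real.exp (-s ^ 2 / 2) *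
          (Real.exp (-(y - 0) ^ 2 / (2 * (1 : ℝ≥0))) * Real.exp (s * y)) := by
        rw [← Real.exp_add, ← Real.exp_add, NNReal.coe_one]
        ring_nf
      rw [hquad]
      ring_nf
    simp only [Pi.mul_apply, hpdf]
    ring
  have hexp (s : ℝ) : ∫⁻ y, ENNReal.ofReal (Real.exp (s * y)) ∂(gaussianReal 0 1).withDensity a =
      ∫⁻ y, ENNReal.ofReal (Real.exp (s * y)) ∂(gaussianReal 0 1).withDensity b := by
    have h := hab s
    rw [shift a ha.measurable, shift b hb.measurable] at h
    exact (ENNReal.mul_right_inj (by simp [Real.exp_pos]) ENNReal.ofReal_ne_top).1 h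
  have hfin (c : ℝ → ℝ≥0∞) (hcK : ∀ y, c y ≤ K) : ∫⁻ y, c y ∂gaussianReal 0 1 ≠ ∞ :=
    ((lintegral_mono hcK).trans_lt (by simp)).ne
  have : IsFiniteMeasure ((gaussianReal 0 1).withDensity a) :=
    isFiniteMeasure_withDensity (hfin a haK)
  have : IsFiniteMeasure ((gaussianReal 0 1).withDensity b) :=
    isFiniteMeasure_withDensity (hfin b hbK)
  have hmgf : mgf id ((gaussianReal 0 1).withDensity a) =
      mgf id ((gaussianReal 0 1).withDensity b) := by
    ext s
    simp only [mgf, id]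
    rw [integral_eq_lintegral_of_nonneg_ae (.of_forall fun _ ↦ Real.exp_nonneg _) (by fun_prop),
      integral_eq_lintegral_of_nonneg_ae (.of_forall fun _ ↦ Real.exp_nonneg _) (by fun_prop),
      hexp]
  have hzero : (gaussianReal 0 1).withDensity a = 0 ↔ (gaussianReal 0 1).withDensity b = 0 := by
    rw [← Measure.measure_univ_eq_zero, ← Measure.measure_univ_eq_zero]
    have := hexp 0
    simp only [zero_mul, Real.exp_zero, ENNReal.ofReal_one, lintegral_one] at this
    rw [this]
  have hset : integrableExpSet id ((gaussianReal 0 1).withDensity a) = Set.univ := by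
    refine Set.eq_univ_of_forall fun s ↦ ?_
    have hle : (gaussianReal 0 1).withDensity a ≤ (K : ℝ≥0∞) • gaussianReal 0 1 := by
      rw [← withDensity_const]
      exact withDensity_mono (.of_forall haK)
    have hs : Integrable (fun y ↦ Real.exp (s * y)) (gaussianReal 0 1) :=
      integrable_exp_mul_gaussianReal s
    exact (hs.smul_measure ENNReal.coe_ne_top).mono_measure hle
  have heq : (gaussianReal 0 1).withDensity a = (gaussianReal 0 1).withDensity b := by
    refine Measure.ext_of_complexMGF_id_eq (funext fun z ↦ ?_)
    exact eqOn_complexMGF_of_mgf' hmgf hzero (by simp [hset])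
  rw [withDensity_eq_iff ha.aemeasurable hb.aemeasurable (hfin a haK)] at heq
  have : (gaussianReal 0 1).IsOpenPosMeasure :=
    (gaussianReal_absolutelyContinuous' 0 one_ne_zero).isOpenPosMeasure
  exact (ha.ae_eq_iff_eq _ hb).1 heq

/-- The law of a random measure is determined by the joint laws of its values on finitely many
measurable sets. -/
lemma MeasureTheory.Measure.ext_of_lintegral_boundedContinuous_eval {X : Type*}
    [MeasurableSpace X] {μ ν : Measure (Measure X)} [IsFiniteMeasure μ] [IsFiniteMeasure ν]
    (h : ∀ (I : Finset {A : Set X // MeasurableSet A}) (g : (I → ℝ≥0∞) →ᵇ ℝ≥0),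
      ∫⁻ m, g (fun i ↦ m i) ∂μ = ∫⁻ m, g (fun i ↦ m i) ∂ν) :
    μ = ν := by
  set e : Measure X → {A : Set X // MeasurableSet A} → ℝ≥0∞ := fun m A ↦ m A
  have hem : Measurable e := measurable_pi_lambda _ fun A ↦ Measure.measurable_coe A.2
  have hfd (I : Finset {A : Set X // MeasurableSet A}) :
      (μ.map e).map I.restrict = (ν.map e).map I.restrict := by
    refine ext_of_forall_lintegral_eq_of_IsFiniteMeasure fun g ↦ ?_
    have hg : Measurable fun x ↦ (g x : ℝ≥0∞) := g.continuous.measurable.coe_nnreal_ennreal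
    rw [Measure.map_map (by fun_prop) hem, Measure.map_map (by fun_prop) hem,
      lintegral_map hg (by fun_prop), lintegral_map hg (by fun_prop)]
    exact h I g
  have hmap : μ.map e = ν.map e :=
    IsProjectiveLimit.unique (P := fun I ↦ (ν.map e).map I.restrict) hfd fun _ ↦ rfl
  have hle : (Measure.instMeasurableSpace : MeasurableSpace (Measure X)) ≤
      MeasurableSpace.pi.comap e := by
    refine iSup₂_le fun A hA ↦ ?_
    rw [← measurable_iff_comap_le]
    let := MeasurableSpace.pi.comap e
    exact (measurable_pi_apply (⟨A, hA⟩ : {A : Set X // MeasurableSet A})).comp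
      (comap_measurable e)
  ext S hS
  obtain ⟨T, hT, rfl⟩ := hle S hS
  rw [← Measure.map_apply hem hT, hmap, Measure.map_apply hem hT]

/-- The measure with density `x ↦ exp (f x * y)` with respect to `μ`. -/
noncomputable def expDensity {X : Type*} [MeasurableSpace X] (f : X → ℝ) (y : ℝ)
    (μ : Measure X) : Measure X :=
  μ.withDensity fun x ↦ ENNReal.ofReal (Real.exp (f x * y))

/-- The map sending a finite measure to itself and an infinite measure to `0`. -/
noncomputable def finitePart {X : Type*} [MeasurableSpace X] (μ : Measure X) : Measure X :=
  open Classical in if μ Set.univ < ∞ then μ else 0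

section

variable {X : Type*} [MeasurableSpace X]

lemma finitePart_of_isFiniteMeasure (μ : Measure X) [IsFiniteMeasure μ] : finitePart μ = μ :=
  if_pos (measure_lt_top μ _)

instance (μ : Measure X) : IsFiniteMeasure (finitePart μ) := by
  unfold finitePart
  split_ifs with h
  · exact ⟨h⟩
  · infer_instance

lemma measurable_finitePart : Measurable (finitePart : Measure X → Measure X) :=
  Measurable.ite (measurableSet_lt (Measure.measurable_coe .univ) measurable_const)
    measurable_id measurable_const

variable {f : X → ℝ}

lemma expDensity_zero (μ : Measure X) : expDensity f 0 μ = μ := by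
  simp [expDensity]

lemma expDensity_expDensity (hf : Measurable f) (s y : ℝ) (μ : Measure X) :
    expDensity f s (expDensity f y μ) = expDensity f (s + y) μ := by
  rw [expDensity, expDensity, ← withDensity_mul _ (by fun_prop) (by fun_prop), expDensity]
  congr 1 with x
  rw [Pi.mul_apply, ← ENNReal.ofReal_mul (Real.exp_nonneg _), ← Real.exp_add]
  ring_nf

lemma measurable_expDensity (hf : Measurable f) (y : ℝ) : Measurable (expDensity f y) := by
  refine Measure.measurable_of_measurable_coe _ fun A hA ↦ ?_
  simp_rw [expDensity, withDensity_apply _ hA, ← lintegral_indicator hA]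
  exact Measure.measurable_lintegral (Measurable.indicator (by fun_prop) hA)

lemma continuous_expDensity_apply (hf : Measurable f) {C : ℝ} (hC : ∀ x, |f x| ≤ C)
    (μ : Measure X) [IsFiniteMeasure μ] {A : Set X} (hA : MeasurableSet A) :
    Continuous fun y ↦ expDensity f y μ A := by
  simp_rw [expDensity, withDensity_apply _ hA]
  refine continuous_iff_continuousAt.2 fun y₀ ↦ ?_
  refine tendsto_lintegral_filter_of_dominated_convergence
    (fun _ ↦ ENNReal.ofReal (Real.exp (C * (|y₀| + 1)))) (.of_forall fun y ↦ by fun_prop) ?_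
    (by simp [ENNReal.mul_eq_top]) (.of_forall fun x ↦ ?_)
  · filter_upwards [Metric.ball_mem_nhds y₀ one_pos] with y hy
    refine .of_forall fun x ↦ ENNReal.ofReal_le_ofReal (Real.exp_le_exp.2 ?_)
    have hy' : |y| ≤ |y₀| + 1 := by
      rw [Metric.mem_ball, Real.dist_eq] at hy
      linarith [abs_sub_abs_le_abs_sub y y₀]
    calc f x * y ≤ |f x * y| := le_abs_self _
      _ = |f x| * |y| := abs_mul _ _
      _ ≤ C * (|y₀| + 1) :=
        mul_le_mul (hC x) hy' (abs_nonneg _) ((abs_nonneg _).trans (hC x))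
  · exact (show Continuous fun y ↦ ENNReal.ofReal (Real.exp (f x * y)) from
      ENNReal.continuous_ofReal.comp (by fun_prop)).continuousAt

lemma measurable_expDensity_finitePart (hf : Measurable f) {C : ℝ} (hC : ∀ x, |f x| ≤ C) :
    Measurable fun p : ℝ × Measure X ↦ expDensity f p.1 (finitePart p.2) := by
  refine Measure.measurable_of_measurable_coe _ fun A hA ↦ ?_
  exact measurable_uncurry_of_continuous_of_measurable
    (u := fun y μ ↦ expDensity f y (finitePart μ) A)
    (fun μ ↦ continuous_expDensity_apply hf hC _ hA)
    fun y ↦ (Measure.measurable_coe hA).comp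
      ((measurable_expDensity hf y).comp measurable_finitePart)

variable {Ω : Type*} [MeasurableSpace Ω] {P : Measure Ω} [IsProbabilityMeasure P]

lemma map_expDensity (hf : Measurable f) {C : ℝ} (hC : ∀ x, |f x| ≤ C)
    {M : Ω → Measure X} (hM : Measurable M) (hMfin : ∀ᵐ ω ∂P, IsFiniteMeasure (M ω))
    {Y : Ω → ℝ} (hY : Measurable Y) (hYM : IndepFun Y M P) :
    P.map (fun ω ↦ expDensity f (Y ω) (M ω)) =
      ((P.map Y).prod (P.map M)).map fun p ↦ expDensity f p.1 (finitePart p.2) := by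
  have hae : (fun ω ↦ expDensity f (Y ω) (M ω)) =ᵐ[P]
      fun ω ↦ expDensity f (Y ω) (finitePart (M ω)) := by
    filter_upwards [hMfin] with ω hω
    rw [finitePart_of_isFiniteMeasure]
  rw [Measure.map_congr hae,
    ← (indepFun_iff_map_prod_eq_prod_map_map hY.aemeasurable hM.aemeasurable).1 hYM,
    Measure.map_map (measurable_expDensity_finitePart hf hC) (hY.prodMk hM)]
  rfl

lemma lintegral_map_expDensity (hf : Measurable f) {C : ℝ} (hC : ∀ x, |f x| ≤ C)
    {M : Ω → Measure X} (hM : Measurable M) (hMfin : ∀ᵐ ω ∂P, IsFiniteMeasure (M ω))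
    {Y : Ω → ℝ} (hY : Measurable Y) (hYM : IndepFun Y M P)
    {F : Measure X → ℝ≥0∞} (hF : Measurable F) :
    ∫⁻ m, F m ∂P.map (fun ω ↦ expDensity f (Y ω) (M ω)) =
      ∫⁻ y, ∫⁻ ω, F (expDensity f y (finitePart (M ω))) ∂P ∂P.map Y := by
  have hjoint := measurable_expDensity_finitePart hf hC
  have hFjoint : Measurable fun p : ℝ × Measure X ↦ F (expDensity f p.1 (finitePart p.2)) :=
    hF.comp hjoint
  have : IsProbabilityMeasure (P.map M) := Measure.isProbabilityMeasure_map hM.aemeasurable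
  have hy (y : ℝ) : ∫⁻ m, F (expDensity f y (finitePart m)) ∂P.map M =
      ∫⁻ ω, F (expDensity f y (finitePart (M ω))) ∂P :=
    lintegral_map (hF.comp ((measurable_expDensity hf y).comp measurable_finitePart)) hM
  rw [map_expDensity hf hC hM hMfin hY hYM, lintegral_map hF hjoint,
    lintegral_prod _ hFjoint.aemeasurable]
  simp_rw [hy]

lemma continuous_lintegral_expDensity (hf : Measurable f) {C : ℝ} (hC : ∀ x, |f x| ≤ C)
    {M : Ω → Measure X} (hM : Measurable M) (I : Finset {A : Set X // MeasurableSet A})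
    (g : (I → ℝ≥0∞) →ᵇ ℝ≥0) :
    Continuous fun y ↦ ∫⁻ ω, g (fun i ↦ expDensity f y (finitePart (M ω)) i) ∂P := by
  refine continuous_iff_continuousAt.2 fun y₀ ↦ ?_
  refine tendsto_lintegral_filter_of_dominated_convergence (fun _ ↦ (nndist g 0 : ℝ≥0∞))
    (.of_forall fun y ↦ ?_) (.of_forall fun y ↦ .of_forall fun ω ↦ ?_) (by simp)
    (.of_forall fun ω ↦ ?_)
  · refine (g.continuous.measurable.comp (measurable_pi_lambda _ fun i ↦ ?_)).coe_nnreal_ennreal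
    exact (Measure.measurable_coe i.1.2).comp
      ((measurable_expDensity hf y).comp (measurable_finitePart.comp hM))
  · exact ENNReal.coe_le_coe.2 (BoundedContinuousFunction.NNReal.upper_bound g _)
  · exact (ENNReal.continuous_coe.comp (g.continuous.comp (continuous_pi fun i ↦
      continuous_expDensity_apply hf hC _ i.1.2))).continuousAt

end

/-- single-Gaussian case of Theorem 3.1: if `e^{𝔥(x)Y} M(dx)` and
`e^{𝔥(x)Y} M̃(dx)` are equal in law, with `Y` a standard Gaussian independent of the
a.s.-finite random measures `M`, `M̃` on a bounded open `D ⊆ ℝ^d` and `𝔥` bounded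
measurable, then `M` and `M̃` are equal in law. -/
theorem statement0 {d : ℕ} (D : Set (EuclideanSpace ℝ (Fin d)))
    (hDopen : IsOpen D) (hDbdd : Bornology.IsBounded D)
    {Ω : Type*} [MeasurableSpace Ω] (P : Measure Ω) [IsProbabilityMeasure P]
    (𝔥 : D → ℝ) (h𝔥meas : Measurable 𝔥) (C : ℝ) (h𝔥bdd : ∀ x, |𝔥 x| ≤ C)
    (M M' : Ω → Measure D) (hMmeas : Measurable M) (hM'meas : Measurable M')
    (hMfin : ∀ᵐ ω ∂P, IsFiniteMeasure (M ω))
    (hM'fin : ∀ᵐ ω ∂P, IsFiniteMeasure (M' ω))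
    (Y : Ω → ℝ) (hYmeas : Measurable Y)
    (hYlaw : P.map Y = gaussianReal 0 1)
    (hYM : IndepFun Y M P) (hYM' : IndepFun Y M' P)
    (hlaw : P.map (fun ω =>
        (M ω).withDensity fun x => ENNReal.ofReal (Real.exp (𝔥 x * Y ω)))
      = P.map (fun ω =>
        (M' ω).withDensity fun x => ENNReal.ofReal (Real.exp (𝔥 x * Y ω)))) :
    P.map M = P.map M' := by
  have : IsProbabilityMeasure (P.map M) := Measure.isProbabilityMeasure_map hMmeas.aemeasurable
  have : IsProbabilityMeasure (P.map M') := Measure.isProbabilityMeasure_map hM'meas.aemeasurable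
  refine Measure.ext_of_lintegral_boundedContinuous_eval fun I g ↦ ?_
  have hF : Measurable fun m : Measure D ↦ (g (fun i ↦ m i) : ENNReal) :=
    (g.continuous.measurable.comp
      (measurable_pi_lambda _ fun i ↦ Measure.measurable_coe i.1.2)).coe_nnreal_ennreal
  have hbound (N : Ω → Measure D) (y : ℝ) :
      ∫⁻ ω, g (fun i ↦ expDensity 𝔥 y (finitePart (N ω)) i) ∂P ≤ nndist g 0 := by
    refine (lintegral_mono fun ω ↦ ENNReal.coe_le_coe.2
      (BoundedContinuousFunction.NNReal.upper_bound g _)).trans ?_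
    simp
  have hsmooth (N : Ω → Measure D) (hN : Measurable N) (hNfin : ∀ᵐ ω ∂P, IsFiniteMeasure (N ω))
      (hYN : IndepFun Y N P) (s : ℝ) :
      ∫⁻ m, g (fun i ↦ expDensity 𝔥 s m i) ∂P.map (fun ω ↦ expDensity 𝔥 (Y ω) (N ω)) =
        ∫⁻ y, ∫⁻ ω, g (fun i ↦ expDensity 𝔥 (s + y) (finitePart (N ω)) i) ∂P
          ∂gaussianReal 0 1 := by
    refine (lintegral_map_expDensity h𝔥meas h𝔥bdd hN hNfin hYmeas hYN
      (hF.comp (measurable_expDensity h𝔥meas s))).trans ?_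
    simp_rw [hYlaw, Function.comp_apply, expDensity_expDensity h𝔥meas]
  have hzero (N : Ω → Measure D) (hN : Measurable N)
      (hNfin : ∀ᵐ ω ∂P, IsFiniteMeasure (N ω)) :
      ∫⁻ m, g (fun i ↦ m i) ∂P.map N =
        ∫⁻ ω, g (fun i ↦ expDensity 𝔥 0 (finitePart (N ω)) i) ∂P := by
    rw [lintegral_map hF hN]
    refine lintegral_congr_ae ?_
    filter_upwards [hNfin] with ω hω
    rw [expDensity_zero, finitePart_of_isFiniteMeasure]
  rw [hzero M hMmeas hMfin, hzero M' hM'meas hM'fin]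
  refine congrFun (eq_of_lintegral_gaussianReal_add_eq
    (continuous_lintegral_expDensity h𝔥meas h𝔥bdd hMmeas I g)
    (continuous_lintegral_expDensity h𝔥meas h𝔥bdd hM'meas I g)
    (hbound M) (hbound M') fun s ↦ ?_) 0
  rw [← hsmooth M hMmeas hMfin hYM, ← hsmooth M' hM'meas hM'fin hYM']
  exact congrArg (fun μ ↦ ∫⁻ m, g (fun i ↦ expDensity 𝔥 s m i) ∂μ) hlaw
end

section
/- Let D ⊆ ℝ^d be a bounded open set, let 𝔥 : D → ℝ and f : D → [0,∞) be bounded Borel measurable functions, let M be a random Borel measure on D that is almost surely finite, and let Y be a standard Gaussian random variable independent of M. Define φ : ℝ × [0,∞) → [0,1] by φ(λ,t) := E[ exp( − ∫_D e^{√t·𝔥(x)·Y − λ·𝔥(x)} f(x) M(dx) ) ]. Then φ is continuous on ℝ × [0,∞), infinitely differentiable on ℝ × (0,∞), and satisfies the heat equation ∂φ/∂t = (1/2)·∂²φ/∂λ² at every point (λ,t) ∈ ℝ × (0,∞). -/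
open MeasureTheory ProbabilityTheory

/-- The unnormalised heat kernel at time `p.2`, centred at `p.1`, times the `k`-th power of the
displacement. -/
noncomputable def gaussMonomial (k : ℕ) (p : ℝ × ℝ) (y : ℝ) : ℝ :=
  (p.1 - y) ^ k * Real.exp (-(p.1 - y) ^ 2 / (2 * p.2))

/-- The integral of `G` against `gaussMonomial k p`. -/
noncomputable def gaussMoment (G : ℝ → ℝ) (k : ℕ) (p : ℝ × ℝ) : ℝ :=
  ∫ y, G y * gaussMonomial k p y

/-- The Fréchet derivative of `gaussMonomial k` in its parameter. -/
noncomputable def gaussMonomialFDeriv (k : ℕ) (p : ℝ × ℝ) (y : ℝ) : ℝ × ℝ →L[ℝ] ℝ :=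
  (k * gaussMonomial (k - 1) p y - p.2⁻¹ * gaussMonomial (k + 1) p y) •
      ContinuousLinearMap.fst ℝ ℝ ℝ +
    ((2 * p.2 ^ 2)⁻¹ * gaussMonomial (k + 2) p y) • ContinuousLinearMap.snd ℝ ℝ ℝ

lemma continuous_gaussMonomial (k : ℕ) (p : ℝ × ℝ) : Continuous (gaussMonomial k p) := by
  unfold gaussMonomial
  fun_prop

lemma continuous_gaussMonomialFDeriv (k : ℕ) (p : ℝ × ℝ) :
    Continuous (gaussMonomialFDeriv k p) := by
  have := continuous_gaussMonomial (k - 1) p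
  have := continuous_gaussMonomial (k + 1) p
  have := continuous_gaussMonomial (k + 2) p
  unfold gaussMonomialFDeriv
  fun_prop

lemma hasFDerivAt_gaussMonomial (k : ℕ) (p : ℝ × ℝ) (hp : 0 < p.2) (y : ℝ) :
    HasFDerivAt (fun q => gaussMonomial k q y) (gaussMonomialFDeriv k p y) p := by
  have h1 : HasFDerivAt (fun q : ℝ × ℝ => q.1 - y) (ContinuousLinearMap.fst ℝ ℝ ℝ) p :=
    hasFDerivAt_fst.sub_const y
  have h2 : HasFDerivAt (fun q : ℝ × ℝ => 2 * q.2) ((2 : ℝ) • ContinuousLinearMap.snd ℝ ℝ ℝ) p :=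
    hasFDerivAt_snd.const_mul 2
  have h2' := (hasDerivAt_inv (by positivity : 2 * p.2 ≠ 0)).comp_hasFDerivAt p h2
  have h3 := ((h1.pow 2).neg.mul h2').exp
  have h4 := (h1.pow k).mul h3
  refine (h4.congr_fderiv ?_)
  ext
  · simp [gaussMonomialFDeriv, gaussMonomial, div_eq_mul_inv]
    field_simp
    ring
  · simp [gaussMonomialFDeriv, gaussMonomial, div_eq_mul_inv]
    field_simp
    ring

lemma exists_gaussMonomial_bound (k : ℕ) (x₀ : ℝ) {t₀ : ℝ} (ht₀ : 0 < t₀) :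
    ∃ B : ℝ, 0 ≤ B ∧ ∀ p : ℝ × ℝ, |p.1 - x₀| < 1 → t₀ / 2 < p.2 → p.2 < 2 * t₀ → ∀ y : ℝ,
      |gaussMonomial k p y| ≤ B * Real.exp (-(1 / (16 * t₀)) * (y - x₀) ^ 2) := by
  refine ⟨k.factorial * Real.exp (2 * t₀ + 1 / (8 * t₀)), by positivity, ?_⟩
  rintro ⟨x, t⟩ hx ht1 ht2 y
  simp only at hx ht1 ht2
  have ht : 0 < t := by linarith
  have hpow : |x - y| ^ k ≤ k.factorial * Real.exp |x - y| := by
    have := Real.pow_div_factorial_le_exp |x - y| (abs_nonneg _) k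
    rwa [div_le_iff₀ (by positivity), mul_comm] at this
  have hexp : -(x - y) ^ 2 / (2 * t) ≤ -((x - y) ^ 2 / (4 * t₀)) := by
    rw [neg_div, neg_le_neg_iff]
    exact div_le_div_of_nonneg_left (sq_nonneg _) (by positivity) (by linarith)
  have habs : |x - y| ≤ (x - y) ^ 2 / (8 * t₀) + 2 * t₀ := by
    rw [← sub_le_iff_le_add, le_div_iff₀ (by positivity), ← sq_abs]
    nlinarith [sq_nonneg (|x - y| - 4 * t₀)]
  have hshift : (y - x₀) ^ 2 / (16 * t₀) ≤ (x - y) ^ 2 / (8 * t₀) + 1 / (8 * t₀) := by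
    have hx2 : (x - x₀) ^ 2 ≤ 1 := by
      rw [← sq_abs]; nlinarith [abs_nonneg (x - x₀)]
    rw [← add_div, div_le_div_iff₀ (by positivity) (by positivity)]
    have : (y - x₀) ^ 2 ≤ 2 * ((x - y) ^ 2 + 1) := by nlinarith [sq_nonneg (x - y + (x - x₀))]
    nlinarith
  have hsplit : (x - y) ^ 2 / (4 * t₀) = (x - y) ^ 2 / (8 * t₀) + (x - y) ^ 2 / (8 * t₀) := by
    ring
  simp only [gaussMonomial, abs_mul, abs_pow, Real.abs_exp]
  calc |x - y| ^ k * Real.exp (-(x - y) ^ 2 / (2 * t))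
      ≤ (k.factorial * Real.exp |x - y|) * Real.exp (-((x - y) ^ 2 / (4 * t₀))) := by gcongr
    _ = k.factorial * Real.exp (|x - y| + -((x - y) ^ 2 / (4 * t₀))) := by
      rw [Real.exp_add]; ring
    _ ≤ k.factorial * Real.exp (2 * t₀ + 1 / (8 * t₀) + -(1 / (16 * t₀)) * (y - x₀) ^ 2) := by
      have : -(1 / (16 * t₀)) * (y - x₀) ^ 2 = -((y - x₀) ^ 2 / (16 * t₀)) := by ring
      gcongr _ * Real.exp ?_
      linarith
    _ = _ := by rw [Real.exp_add (2 * t₀ + _)]; ring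

lemma integrable_exp_neg_mul_sub_sq {b : ℝ} (hb : 0 < b) (x₀ : ℝ) :
    Integrable fun y : ℝ => Real.exp (-b * (y - x₀) ^ 2) :=
  (integrable_exp_neg_mul_sq hb).comp_sub_right x₀

lemma integrable_mul_gaussMonomial {G : ℝ → ℝ} (hG : Measurable G) (hG1 : ∀ y, |G y| ≤ 1)
    (k : ℕ) {p : ℝ × ℝ} (hp : 0 < p.2) : Integrable fun y => G y * gaussMonomial k p y := by
  obtain ⟨B, -, hB⟩ := exists_gaussMonomial_bound k p.1 hp
  refine ((integrable_exp_neg_mul_sub_sq (b := 1 / (16 * p.2)) (by positivity) p.1).const_mul B).mono'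
    (hG.mul (continuous_gaussMonomial k p).measurable).aestronglyMeasurable (ae_of_all _ fun y => ?_)
  rw [Real.norm_eq_abs, abs_mul]
  exact (mul_le_of_le_one_left (abs_nonneg _) (hG1 y)).trans
    (hB p (by simp) (by linarith) (by linarith) y)

lemma hasFDerivAt_gaussMoment {G : ℝ → ℝ} (hG : Measurable G) (hG1 : ∀ y, |G y| ≤ 1)
    (k : ℕ) {p : ℝ × ℝ} (hp : 0 < p.2) :
    HasFDerivAt (gaussMoment G k)
      ((k * gaussMoment G (k - 1) p - p.2⁻¹ * gaussMoment G (k + 1) p) •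
          ContinuousLinearMap.fst ℝ ℝ ℝ +
        ((2 * p.2 ^ 2)⁻¹ * gaussMoment G (k + 2) p) • ContinuousLinearMap.snd ℝ ℝ ℝ) p := by
  have hint := fun j => integrable_mul_gaussMonomial hG hG1 j hp
  obtain ⟨x₀, t₀⟩ := p
  simp only at hp
  obtain ⟨B₁, hB₁0, hB₁⟩ := exists_gaussMonomial_bound (k - 1) x₀ hp
  obtain ⟨B₂, hB₂0, hB₂⟩ := exists_gaussMonomial_bound (k + 1) x₀ hp
  obtain ⟨B₃, hB₃0, hB₃⟩ := exists_gaussMonomial_bound (k + 2) x₀ hp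
  let s : Set (ℝ × ℝ) := {q | |q.1 - x₀| < 1 ∧ t₀ / 2 < q.2 ∧ q.2 < 2 * t₀}
  have hs : s ∈ nhds (x₀, t₀) := by
    refine IsOpen.mem_nhds ?_ ⟨by simp, by simp only; linarith, by simp only; linarith⟩
    exact (isOpen_lt (continuous_fst.sub continuous_const).abs continuous_const).inter
      ((isOpen_lt continuous_const continuous_snd).inter (isOpen_lt continuous_snd continuous_const))
  have key := hasFDerivAt_integral_of_dominated_of_fderiv_le (μ := volume) (𝕜 := ℝ)
    (F := fun q y => G y * gaussMonomial k q y)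
    (F' := fun q y => G y • gaussMonomialFDeriv k q y)
    (bound := fun y => (k * B₁ + (t₀ / 2)⁻¹ * B₂ + (2 * (t₀ / 2) ^ 2)⁻¹ * B₃) *
      Real.exp (-(1 / (16 * t₀)) * (y - x₀) ^ 2)) hs
    (Filter.Eventually.of_forall fun q =>
      (hG.mul (continuous_gaussMonomial k q).measurable).aestronglyMeasurable)
    (hint k)
    (hG.aestronglyMeasurable.smul (continuous_gaussMonomialFDeriv k _).aestronglyMeasurable)
    (ae_of_all _ ?_)
    ((integrable_exp_neg_mul_sub_sq (by positivity) x₀).const_mul _)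
    (ae_of_all _ fun y q hq =>
      (hasFDerivAt_gaussMonomial k q (by have := hq.2.1; linarith) y).const_mul (G y))
  · refine key.congr_fderiv ?_
    have hF : ∀ y, G y • gaussMonomialFDeriv k (x₀, t₀) y =
        (k * (G y * gaussMonomial (k - 1) (x₀, t₀) y) -
            t₀⁻¹ * (G y * gaussMonomial (k + 1) (x₀, t₀) y)) • ContinuousLinearMap.fst ℝ ℝ ℝ +
          ((2 * t₀ ^ 2)⁻¹ * (G y * gaussMonomial (k + 2) (x₀, t₀) y)) •
            ContinuousLinearMap.snd ℝ ℝ ℝ := by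
      intro y
      simp only [gaussMonomialFDeriv, smul_add, smul_smul]
      congr 2 <;> ring
    simp only [hF]
    have h1 := (hint (k - 1)).const_mul (k : ℝ)
    have h2 := (hint (k + 1)).const_mul t₀⁻¹
    have h3 := (hint (k + 2)).const_mul (2 * t₀ ^ 2)⁻¹
    have h12 : Integrable fun y => k * (G y * gaussMonomial (k - 1) (x₀, t₀) y) -
        t₀⁻¹ * (G y * gaussMonomial (k + 1) (x₀, t₀) y) := h1.sub h2
    rw [integral_add (h12.smul_const _) (h3.smul_const _), integral_smul_const,
      integral_smul_const, integral_sub h1 h2]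
    simp only [integral_const_mul, gaussMoment]
  · rintro y q ⟨hq1, hq2, hq3⟩
    have hb₁ := hB₁ q hq1 hq2 hq3 y
    have hb₂ := hB₂ q hq1 hq2 hq3 y
    have hb₃ := hB₃ q hq1 hq2 hq3 y
    have hq : 0 < q.2 := by linarith
    set e := Real.exp (-(1 / (16 * t₀)) * (y - x₀) ^ 2)
    rw [norm_smul]
    refine (mul_le_of_le_one_left (norm_nonneg _) (hG1 y)).trans ?_
    calc ‖gaussMonomialFDeriv k q y‖
        ≤ ‖k * gaussMonomial (k - 1) q y - q.2⁻¹ * gaussMonomial (k + 1) q y‖ * 1 +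
          ‖(2 * q.2 ^ 2)⁻¹ * gaussMonomial (k + 2) q y‖ * 1 := by
          refine (norm_add_le _ _).trans ?_
          rw [norm_smul, norm_smul]
          gcongr
          · exact ContinuousLinearMap.norm_fst_le ..
          · exact ContinuousLinearMap.norm_snd_le ..
      _ ≤ (k * |gaussMonomial (k - 1) q y| + q.2⁻¹ * |gaussMonomial (k + 1) q y|) +
          (2 * q.2 ^ 2)⁻¹ * |gaussMonomial (k + 2) q y| := by
          rw [mul_one, mul_one]
          refine add_le_add ((norm_sub_le _ _).trans (le_of_eq ?_)) (le_of_eq ?_)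
          · simp [abs_of_pos hq]
          · simp
      _ ≤ (k * (B₁ * e) + (t₀ / 2)⁻¹ * (B₂ * e)) + (2 * (t₀ / 2) ^ 2)⁻¹ * (B₃ * e) := by
          gcongr
      _ = _ := by ring

lemma contDiffOn_gaussMoment {G : ℝ → ℝ} (hG : Measurable G) (hG1 : ∀ y, |G y| ≤ 1) (k : ℕ) :
    ContDiffOn ℝ (⊤ : ℕ∞) (gaussMoment G k) (Set.univ ×ˢ Set.Ioi 0) := by
  have hopen : IsOpen ((Set.univ : Set ℝ) ×ˢ Set.Ioi (0 : ℝ)) := isOpen_univ.prod isOpen_Ioi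
  have hd : ∀ j, ∀ p ∈ (Set.univ : Set ℝ) ×ˢ Set.Ioi (0 : ℝ), _ :=
    fun j p hp => hasFDerivAt_gaussMoment hG hG1 j (p := p) hp.2
  rw [contDiffOn_infty]
  intro n
  induction n generalizing k with
  | zero =>
    exact contDiffOn_zero.2 fun p hp => (hd k p hp).continuousAt.continuousWithinAt
  | succ n ih =>
    push_cast
    rw [contDiffOn_succ_iff_fderiv_of_isOpen hopen]
    refine ⟨fun p hp => (hd k p hp).differentiableAt.differentiableWithinAt, by simp, ?_⟩
    refine ContDiffOn.congr ?_ fun p hp => (hd k p hp).fderiv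
    have hsnd : ContDiffOn ℝ n (fun p : ℝ × ℝ => p.2) (Set.univ ×ˢ Set.Ioi 0) :=
      contDiff_snd.contDiffOn
    have hinv := hsnd.inv fun p hp => ne_of_gt hp.2
    have hinv2 := ((contDiffOn_const (c := (2 : ℝ))).mul (hsnd.pow 2)).inv fun p hp =>
      ne_of_gt (mul_pos two_pos (pow_pos hp.2 2))
    exact (((contDiffOn_const.mul (ih (k - 1))).sub (hinv.mul (ih (k + 1)))).smul
      contDiffOn_const).add ((hinv2.mul (ih (k + 2))).smul contDiffOn_const)

/-- The heat semigroup applied to `G`, as the normalised zeroth Gaussian moment. -/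
noncomputable def heatExtension (G : ℝ → ℝ) (p : ℝ × ℝ) : ℝ :=
  (√(2 * Real.pi * p.2))⁻¹ * gaussMoment G 0 p

lemma contDiffOn_heatExtension {G : ℝ → ℝ} (hG : Measurable G) (hG1 : ∀ y, |G y| ≤ 1) :
    ContDiffOn ℝ (⊤ : ℕ∞) (heatExtension G) (Set.univ ×ˢ Set.Ioi 0) := by
  have hpos : ∀ p ∈ (Set.univ : Set ℝ) ×ˢ Set.Ioi (0 : ℝ), 0 < 2 * Real.pi * p.2 :=
    fun p hp => mul_pos (by positivity) hp.2
  have hsnd : ContDiffOn ℝ (⊤ : ℕ∞) (fun p : ℝ × ℝ => 2 * Real.pi * p.2)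
      (Set.univ ×ˢ Set.Ioi 0) := (contDiff_const.mul contDiff_snd).contDiffOn
  exact ((hsnd.sqrt fun p hp => (hpos p hp).ne').inv fun p hp =>
    (Real.sqrt_pos.2 (hpos p hp)).ne').mul (contDiffOn_gaussMoment hG hG1 0)

lemma hasDerivAt_gaussMoment_fst {G : ℝ → ℝ} (hG : Measurable G) (hG1 : ∀ y, |G y| ≤ 1)
    (k : ℕ) (x : ℝ) {t : ℝ} (ht : 0 < t) :
    HasDerivAt (fun x => gaussMoment G k (x, t))
      (k * gaussMoment G (k - 1) (x, t) - t⁻¹ * gaussMoment G (k + 1) (x, t)) x := by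
  have h := (hasFDerivAt_gaussMoment hG hG1 k (p := (x, t)) ht).comp_hasDerivAt x
    ((hasDerivAt_id x).prodMk (hasDerivAt_const x t))
  exact h.congr_deriv (by simp)

lemma hasDerivAt_gaussMoment_snd {G : ℝ → ℝ} (hG : Measurable G) (hG1 : ∀ y, |G y| ≤ 1)
    (k : ℕ) (x : ℝ) {t : ℝ} (ht : 0 < t) :
    HasDerivAt (fun t => gaussMoment G k (x, t))
      ((2 * t ^ 2)⁻¹ * gaussMoment G (k + 2) (x, t)) t := by
  have h := (hasFDerivAt_gaussMoment hG hG1 k (p := (x, t)) ht).comp_hasDerivAt t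
    ((hasDerivAt_const t x).prodMk (hasDerivAt_id t))
  exact h.congr_deriv (by simp)

lemma deriv_heatExtension {G : ℝ → ℝ} (hG : Measurable G) (hG1 : ∀ y, |G y| ≤ 1)
    (x : ℝ) {t : ℝ} (ht : 0 < t) :
    deriv (fun s => heatExtension G (x, s)) t =
      (1 / 2) * deriv (deriv fun l => heatExtension G (l, t)) x := by
  have hx : (deriv fun l => heatExtension G (l, t)) =
      fun l => (√(2 * Real.pi * t))⁻¹ * (-t⁻¹ * gaussMoment G 1 (l, t)) := by
    funext l
    simpa [heatExtension] using
      ((hasDerivAt_gaussMoment_fst hG hG1 0 l ht).const_mul (√(2 * Real.pi * t))⁻¹).deriv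
  have hxx := (((hasDerivAt_gaussMoment_fst hG hG1 1 x ht).const_mul (-t⁻¹)).const_mul
    (√(2 * Real.pi * t))⁻¹).deriv
  have hpos : 0 < 2 * Real.pi * t := by positivity
  have hsqrt := ((((hasDerivAt_id t).const_mul (2 * Real.pi)).sqrt hpos.ne').fun_inv
    (Real.sqrt_pos.2 hpos).ne').mul (hasDerivAt_gaussMoment_snd hG hG1 0 x ht)
  rw [hx, hxx]
  refine hsqrt.deriv.trans ?_
  have hsq : √(2 * Real.pi * t) ^ 2 = 2 * Real.pi * t := Real.sq_sqrt hpos.le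
  simp only [id, hsq]
  have := (Real.sqrt_pos.2 hpos).ne'
  have := Real.pi_pos.ne'
  push_cast
  field_simp
  ring

lemma integral_gaussianReal_eq_heatExtension (G : ℝ → ℝ) (hG : Measurable G) (x : ℝ)
    {t : ℝ} (ht : 0 < t) :
    ∫ y, G (x - √t * y) ∂gaussianReal 0 1 = heatExtension G (x, t) := by
  have hmap : (gaussianReal 0 1).map (fun y => x - √t * y) = gaussianReal x (NNReal.mk t ht.le) := by
    have : (fun y => x - √t * y) = (fun y => x + y) ∘ fun y => -√t * y := by
      funext y; simp; ring
    rw [this, ← Measure.map_map (by fun_prop) (by fun_prop), gaussianReal_map_const_mul,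
      gaussianReal_map_const_add]
    congr 1
    · simp
    · ext; simp [Real.sq_sqrt ht.le]
  rw [← integral_map (f := G) (by fun_prop) hG.aestronglyMeasurable, hmap,
    integral_gaussianReal_eq_integral_smul (by simpa [← NNReal.coe_ne_zero] using ht.ne'),
    heatExtension, gaussMoment, ← integral_const_mul]
  congr 1
  funext y
  simp only [gaussianPDFReal_def, gaussMonomial, smul_eq_mul, NNReal.coe_mk]
  rw [← neg_sub y x, neg_sq]
  ring

lemma continuous_integral_gaussianReal {G : ℝ → ℝ} (hG : Continuous G) (hG1 : ∀ y, |G y| ≤ 1) :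
    Continuous fun p : ℝ × ℝ => ∫ y, G (p.1 - √p.2 * y) ∂gaussianReal 0 1 := by
  refine continuous_of_dominated (bound := fun _ => 1)
    (fun p => (hG.comp (by fun_prop)).aestronglyMeasurable) (fun p => ae_of_all _ fun y => hG1 _)
    (integrable_const 1) (ae_of_all _ fun y => hG.comp (by fun_prop))

section LaplaceFunctional

variable {X : Type*} [MeasurableSpace X]

open scoped Classical in
/-- The Laplace functional `exp (-∫ exp (-u h) f dm)`, set to `0` at infinite measures `m`. -/
noncomputable def tiltedLaplace (h f : X → ℝ) (u : ℝ) (m : Measure X) : ℝ :=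
  if m Set.univ < ⊤ then
    Real.exp (-(∫⁻ x, ENNReal.ofReal (Real.exp (-u * h x) * f x) ∂m).toReal) else 0

lemma abs_tiltedLaplace_le (h f : X → ℝ) (u : ℝ) (m : Measure X) :
    |tiltedLaplace h f u m| ≤ 1 := by
  unfold tiltedLaplace
  split_ifs <;> simp

lemma measurable_tiltedLaplace {h f : X → ℝ} (hh : Measurable h) (hf : Measurable f) (u : ℝ) :
    Measurable (tiltedLaplace h f u) := by
  refine Measurable.ite (measurableSet_lt (Measure.measurable_coe .univ) measurable_const) ?_
    measurable_const
  have := Measure.measurable_lintegral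
    (f := fun x => ENNReal.ofReal (Real.exp (-u * h x) * f x)) (by fun_prop)
  exact Real.measurable_exp.comp this.ennreal_toReal.neg

lemma continuous_tiltedLaplace {h f : X → ℝ} (hh : Measurable h) (hf : Measurable f)
    {C Cf : ℝ} (hC : ∀ x, |h x| ≤ C) (hf0 : ∀ x, 0 ≤ f x) (hCf : ∀ x, f x ≤ Cf)
    (m : Measure X) : Continuous fun u => tiltedLaplace h f u m := by
  unfold tiltedLaplace
  split_ifs with hm
  swap; · exact continuous_const
  have : IsFiniteMeasure m := ⟨hm⟩
  have heq : ∀ u, (∫⁻ x, ENNReal.ofReal (Real.exp (-u * h x) * f x) ∂m).toReal =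
      ∫ x, Real.exp (-u * h x) * f x ∂m := fun u =>
    (integral_eq_lintegral_of_nonneg_ae
      (ae_of_all _ fun x => mul_nonneg (Real.exp_nonneg _) (hf0 x))
      (by fun_prop)).symm
  simp only [heq]
  refine Real.continuous_exp.comp (Continuous.neg ?_)
  refine continuous_iff_continuousAt.2 fun u₀ => ?_
  refine continuousAt_of_dominated (bound := fun _ => Real.exp ((|u₀| + 1) * C) * Cf)
    (Filter.Eventually.of_forall fun u => by fun_prop) ?_ (integrable_const _)
    (ae_of_all _ fun x => by fun_prop)
  filter_upwards [Metric.ball_mem_nhds u₀ one_pos] with u hu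
  refine ae_of_all _ fun x => ?_
  rw [Metric.mem_ball, Real.dist_eq] at hu
  have hu' : |u| ≤ |u₀| + 1 := by
    have := abs_sub_abs_le_abs_sub u u₀
    linarith
  rw [Real.norm_eq_abs, abs_mul, Real.abs_exp, abs_of_nonneg (hf0 x)]
  refine mul_le_mul (Real.exp_le_exp.2 ?_) (hCf x) (hf0 x) (Real.exp_nonneg _)
  calc -u * h x ≤ |-u * h x| := le_abs_self _
    _ = |u| * |h x| := by rw [abs_mul, abs_neg]
    _ ≤ (|u₀| + 1) * C := mul_le_mul hu' (hC x) (abs_nonneg _) (by positivity)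

end LaplaceFunctional

/-- Lemma 3.2: the function
`φ(λ,t) = E[exp(−∫_D e^{√t·𝔥(x)·Y − λ·𝔥(x)} f(x) M(dx))]` is continuous on
`ℝ × [0,∞)`, smooth on `ℝ × (0,∞)`, and solves the heat equation
`∂φ/∂t = ½ ∂²φ/∂λ²` there. -/
theorem statement2 {d : ℕ} (D : Set (EuclideanSpace ℝ (Fin d)))
    (hDopen : IsOpen D) (hDbdd : Bornology.IsBounded D)
    {Ω : Type*} [MeasurableSpace Ω] (P : Measure Ω) [IsProbabilityMeasure P]
    (𝔥 : D → ℝ) (h𝔥meas : Measurable 𝔥) (C : ℝ) (h𝔥bdd : ∀ x, |𝔥 x| ≤ C)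
    (f : D → ℝ) (hfmeas : Measurable f) (hfnonneg : ∀ x, 0 ≤ f x)
    (Cf : ℝ) (hfbdd : ∀ x, f x ≤ Cf)
    (M : Ω → Measure D) (hMmeas : Measurable M)
    (hMfin : ∀ᵐ ω ∂P, IsFiniteMeasure (M ω))
    (Y : Ω → ℝ) (hYmeas : Measurable Y)
    (hYlaw : P.map Y = gaussianReal 0 1)
    (hYM : IndepFun Y M P)
    (φ : ℝ → ℝ → ℝ)
    (hφ : ∀ lam t : ℝ, 0 ≤ t → φ lam t =
      ∫ ω, Real.exp (-(∫⁻ x, ENNReal.ofReal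
        (Real.exp (Real.sqrt t * 𝔥 x * Y ω - lam * 𝔥 x) * f x) ∂(M ω)).toReal) ∂P) :
    ContinuousOn (fun p : ℝ × ℝ => φ p.1 p.2) (Set.univ ×ˢ Set.Ici 0) ∧
    ContDiffOn ℝ (⊤ : ℕ∞) (fun p : ℝ × ℝ => φ p.1 p.2) (Set.univ ×ˢ Set.Ioi 0) ∧
    ∀ lam t : ℝ, 0 < t →
      deriv (fun s => φ lam s) t
        = (1 / 2) * deriv (deriv (fun l => φ l t)) lam := by
  set ν := P.map M
  have hνprob : IsProbabilityMeasure ν := Measure.isProbabilityMeasure_map hMmeas.aemeasurable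
  let G : ℝ → ℝ := fun u => ∫ m, tiltedLaplace 𝔥 f u m ∂ν
  have hGcont : Continuous G :=
    continuous_of_dominated (bound := fun _ => 1)
      (fun u => (measurable_tiltedLaplace h𝔥meas hfmeas u).aestronglyMeasurable)
      (fun u => ae_of_all _ fun m => abs_tiltedLaplace_le 𝔥 f u m) (integrable_const 1)
      (ae_of_all _ fun m => continuous_tiltedLaplace h𝔥meas hfmeas h𝔥bdd hfnonneg hfbdd m)
  have hG1 : ∀ u, |G u| ≤ 1 := fun u => by
    simpa using norm_integral_le_of_norm_le_const (μ := ν) (f := tiltedLaplace 𝔥 f u)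
      (ae_of_all _ fun m => abs_tiltedLaplace_le 𝔥 f u m)
  have hrep : ∀ lam t : ℝ, 0 ≤ t → φ lam t = ∫ y, G (lam - √t * y) ∂gaussianReal 0 1 := by
    intro lam t ht
    have hjoint : Measurable fun q : ℝ × Measure D =>
        tiltedLaplace 𝔥 f (lam - √t * q.1) q.2 :=
      (measurable_uncurry_of_continuous_of_measurable
        (continuous_tiltedLaplace h𝔥meas hfmeas h𝔥bdd hfnonneg hfbdd)
        (measurable_tiltedLaplace h𝔥meas hfmeas)).comp
        ((measurable_const.sub (measurable_const.mul measurable_fst)).prodMk measurable_snd)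
    calc φ lam t = ∫ ω, tiltedLaplace 𝔥 f (lam - √t * Y ω) (M ω) ∂P := by
          rw [hφ lam t ht]
          refine integral_congr_ae ?_
          filter_upwards [hMfin] with ω hω
          rw [tiltedLaplace, if_pos (measure_lt_top _ _)]
          congr! 8
          ring
      _ = ∫ q, tiltedLaplace 𝔥 f (lam - √t * q.1) q.2 ∂P.map fun ω => (Y ω, M ω) :=
          (integral_map (hYmeas.prodMk hMmeas).aemeasurable hjoint.aestronglyMeasurable).symm
      _ = ∫ q, tiltedLaplace 𝔥 f (lam - √t * q.1) q.2 ∂(gaussianReal 0 1).prod ν := by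
          rw [(indepFun_iff_map_prod_eq_prod_map_map hYmeas.aemeasurable
            hMmeas.aemeasurable).1 hYM, hYlaw]
      _ = _ := integral_prod _ ((integrable_const (1 : ℝ)).mono' hjoint.aestronglyMeasurable
          (ae_of_all _ fun q => abs_tiltedLaplace_le 𝔥 f _ _))
  have hheat : ∀ lam t : ℝ, 0 < t → φ lam t = heatExtension G (lam, t) := fun lam t ht =>
    (hrep lam t ht.le).trans (integral_gaussianReal_eq_heatExtension G hGcont.measurable lam ht)
  refine ⟨?_, ?_, fun lam t ht => ?_⟩
  · exact (continuous_integral_gaussianReal hGcont hG1).continuousOn.congr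
      fun p hp => hrep p.1 p.2 hp.2
  · exact (contDiffOn_heatExtension hGcont.measurable hG1).congr fun p hp => hheat p.1 p.2 hp.2
  · have hs : (fun s => φ lam s) =ᶠ[nhds t] fun s => heatExtension G (lam, s) := by
      filter_upwards [Ioi_mem_nhds ht] with s hs using hheat lam s hs
    have hl : (fun l => φ l t) = fun l => heatExtension G (l, t) :=
      funext fun l => hheat l t ht
    rw [hs.deriv_eq, hl, deriv_heatExtension hGcont.measurable hG1 lam ht]
end

section
/- Let σ > 0 and β ∈ ℝ, and let ν be a Borel measure on ℝ such that for every continuous compactly supported function f : ℝ → [0,∞), one has ∫_ℝ ( ∫_ℝ f(h+x) · (2πσ²)^{-1/2} e^{-x²/(2σ²)} dx ) ν(dh) = ∫_ℝ e^{βh} f(h) dh (both sides possibly infinite, interpreted as integrals of nonnegative functions). Then ν is the measure with density h ↦ e^{-β²σ²/2 + βh} with respect to Lebesgue measure, i.e., ν(A) = ∫_A e^{-β²σ²/2 + βh} dh for every Borel set A ⊆ ℝ. -/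
open MeasureTheory

open ProbabilityTheory in
theorem continuous_gaussianPDFReal (m : ℝ) (v : NNReal) : Continuous (gaussianPDFReal m v) := by
  unfold gaussianPDFReal
  fun_prop

open ProbabilityTheory in
theorem integrable_mul_gaussianPDFReal {f : ℝ → ℝ} (hf : Continuous f)
    (hc : HasCompactSupport f) (m : ℝ) (v : NNReal) :
    Integrable fun y => f y * gaussianPDFReal m v y :=
  (hf.mul (continuous_gaussianPDFReal m v)).integrable_of_hasCompactSupport hc.mul_right

open ProbabilityTheory in
/-- The expectation of `f (h + N(0, v))` is the integral of `f` against the density of `N(h, v)`. -/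
theorem ofReal_integral_add_mul_gaussianPDFReal {f : ℝ → ℝ} (hf : Continuous f)
    (hc : HasCompactSupport f) (h0 : ∀ x, 0 ≤ f x) (v : NNReal) (h : ℝ) :
    ENNReal.ofReal (∫ x, f (h + x) * gaussianPDFReal 0 v x)
      = ∫⁻ y, ENNReal.ofReal (f y) * gaussianPDF h v y := by
  have hshift : ∫ x, f (h + x) * gaussianPDFReal 0 v x = ∫ y, f y * gaussianPDFReal h v y := by
    rw [← integral_add_left_eq_self (fun y => f y * gaussianPDFReal h v y) h]
    simp [add_comm h, gaussianPDFReal_add]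
  rw [hshift, ofReal_integral_eq_lintegral_ofReal (integrable_mul_gaussianPDFReal hf hc h v)
    (.of_forall fun y => mul_nonneg (h0 y) (gaussianPDFReal_nonneg h v y))]
  simp_rw [gaussianPDF, ENNReal.ofReal_mul (h0 _)]

/-- A measure with a positive finite measurable function of finite integral is s-finite. -/
theorem sFinite_of_lintegral_ne_top {α : Type*} [MeasurableSpace α] {ν : Measure α}
    {F : α → ENNReal} (hF : Measurable F) (h0 : ∀ x, F x ≠ 0) (htop : ∀ x, F x ≠ ⊤)
    (hint : ∫⁻ x, F x ∂ν ≠ ⊤) : SFinite ν := by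
  have := isFiniteMeasure_withDensity hint
  rw [← withDensity_inv_same hF (.of_forall h0) (.of_forall htop) (μ := ν)]
  infer_instance

/-- A measure on `ℝ` is determined by its integrals of nonnegative compactly supported continuous
functions as soon as these are those of a locally finite measure. -/
theorem ext_of_lintegral_hasCompactSupport {μ ν : Measure ℝ} [IsLocallyFiniteMeasure ν]
    (h : ∀ f : ℝ → ℝ, Continuous f → HasCompactSupport f → (∀ x, 0 ≤ f x) →
      ∫⁻ x, ENNReal.ofReal (f x) ∂μ = ∫⁻ x, ENNReal.ofReal (f x) ∂ν) : μ = ν := by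
  have : IsFiniteMeasureOnCompacts μ := by
    refine ⟨fun K hK => ?_⟩
    obtain ⟨f, hf1, -, hfc, hf⟩ :=
      exists_continuous_one_zero_of_isCompact hK isClosed_empty (Set.disjoint_empty K)
    have hint : Integrable f ν := f.continuous.integrable_of_hasCompactSupport hfc
    calc μ K = ∫⁻ x in K, 1 ∂μ := by simp
      _ ≤ ∫⁻ x in K, ENNReal.ofReal (f x) ∂μ :=
        setLIntegral_mono' hK.measurableSet fun x hx => by simp [hf1 hx]
      _ ≤ ∫⁻ x, ENNReal.ofReal (f x) ∂μ := setLIntegral_le_lintegral _ _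
      _ = ∫⁻ x, ENNReal.ofReal (f x) ∂ν := h f f.continuous hfc fun x => (hf x).1
      _ < ⊤ := hint.lintegral_lt_top
  refine Measure.ext_of_integral_eq_on_compactlySupported_nnreal fun f => ?_
  have hc : HasCompactSupport fun x => (f x : ℝ) :=
    f.hasCompactSupport.comp_left (g := fun r : NNReal => (r : ℝ)) rfl
  have hcont : Continuous fun x => (f x : ℝ) := by fun_prop
  have h0 : ∀ x, 0 ≤ (f x : ℝ) := fun x => (f x).coe_nonneg
  rw [integral_eq_lintegral_of_nonneg_ae (.of_forall h0) hcont.aestronglyMeasurable,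
    integral_eq_lintegral_of_nonneg_ae (.of_forall h0) hcont.aestronglyMeasurable,
    h _ hcont hc h0]

open ProbabilityTheory in
/-- A measure whose Laplace transform agrees with that of a Gaussian on a dense set is Gaussian. -/
theorem eq_gaussianReal_of_dense {ρ : Measure ℝ} {m : ℝ} {v : NNReal} {S : Set ℝ} (hS : Dense S)
    (h : ∀ t ∈ S, ∫⁻ x, ENNReal.ofReal (Real.exp (t * x)) ∂ρ
      = ENNReal.ofReal (Real.exp (m * t + v * t ^ 2 / 2))) :
    ρ = gaussianReal m v := by
  have hSint : S ⊆ integrableExpSet id ρ := fun t ht => by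
    refine (lintegral_ofReal_ne_top_iff_integrable (by fun_prop)
      (.of_forall fun x => (Real.exp_pos _).le)).1 ?_
    simp [h t ht]
  have hint : ∀ t, Integrable (fun x => Real.exp (t * id x)) ρ := fun t => by
    obtain ⟨a, haS, ha⟩ := hS.exists_lt t
    obtain ⟨b, hbS, hb⟩ := hS.exists_gt t
    exact integrable_exp_mul_of_le_of_le (hSint haS) (hSint hbS) ha.le hb.le
  have hfin : IsFiniteMeasure ρ := by
    simpa [integrable_const_iff] using hint 0
  have hmgf : mgf id ρ = mgf id (gaussianReal m v) := by
    rw [mgf_id_gaussianReal]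
    refine (continuous_mgf hint).ext_on hS (by fun_prop) fun t ht => ?_
    have hlap : ∫⁻ x, ENNReal.ofReal (Real.exp (t * id x)) ∂ρ = _ := h t ht
    rw [← ofReal_integral_eq_lintegral_ofReal (hint t)
      (.of_forall fun x => (Real.exp_pos _).le), ENNReal.ofReal_eq_ofReal_iff
      (integral_nonneg fun x => (Real.exp_pos _).le) (Real.exp_pos _).le] at hlap
    exact hlap
  have hne : ρ ≠ 0 := by
    rintro rfl
    have := congrFun hmgf 0
    simp at this
  refine Measure.ext_of_complexMGF_id_eq (funext fun z =>
    eqOn_complexMGF_of_mgf' hmgf (by simp [hne, IsProbabilityMeasure.ne_zero]) ?_)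
  have huniv : integrableExpSet id ρ = Set.univ := Set.eq_univ_of_forall hint
  simp [huniv]

open ProbabilityTheory in
/-- The density of `N(x, v)` as an exponential tilt of the density of `N(0, v)`. -/
theorem gaussianPDFReal_eq_mul_exp {v : NNReal} (hv : v ≠ 0) (x y : ℝ) :
    gaussianPDFReal x v y
      = Real.exp (-y ^ 2 / (2 * v)) * (gaussianPDFReal 0 v x * Real.exp (y / v * x)) := by
  have hv' : (v : ℝ) ≠ 0 := by exact_mod_cast hv
  simp only [gaussianPDFReal]
  rw [mul_assoc (Real.sqrt _)⁻¹, mul_left_comm (Real.exp _), ← Real.exp_add, ← Real.exp_add]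
  congr 2
  field_simp
  ring

open ProbabilityTheory in
/-- If the convolution of `ν` with `N(0, v)` has density `exp (β y)`, then `ν` is the exponential
measure with the corresponding constant. -/
theorem eq_withDensity_exp_of_ae_lintegral_gaussianPDF {ν : Measure ℝ} {v : NNReal} (hv : v ≠ 0)
    (β : ℝ) (h : ∀ᵐ y, ∫⁻ x, gaussianPDF x v y ∂ν = ENNReal.ofReal (Real.exp (β * y))) :
    ν = volume.withDensity fun x => ENNReal.ofReal (Real.exp (-β ^ 2 * v / 2 + β * x)) := by
  have hv' : (v : ℝ) ≠ 0 := by exact_mod_cast hv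
  have hρ : ν.withDensity (gaussianPDF 0 v) = gaussianReal (β * v) v := by
    refine eq_gaussianReal_of_dense ((Measure.dense_of_ae h).preimage
      (Homeomorph.mulLeft₀ (v : ℝ) hv').isOpenMap) fun t ht => ?_
    simp only [Homeomorph.coe_mulLeft₀, Set.mem_preimage, Set.mem_ofPred_eq] at ht
    have hpt : ∀ x, gaussianPDF x v (v * t) = ENNReal.ofReal (Real.exp (-(v * t) ^ 2 / (2 * v))) *
        (gaussianPDF 0 v x * ENNReal.ofReal (Real.exp (t * x))) := fun x => by
      rw [gaussianPDF, gaussianPDF, gaussianPDFReal_eq_mul_exp hv,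
        ENNReal.ofReal_mul (Real.exp_pos _).le, ENNReal.ofReal_mul (gaussianPDFReal_nonneg _ _ _),
        mul_div_cancel_left₀ t hv']
    rw [lintegral_congr hpt, lintegral_const_mul _ (by fun_prop)] at ht
    rw [lintegral_withDensity_eq_lintegral_mul _ (by fun_prop) (by fun_prop)]
    refine (ENNReal.mul_right_inj (a := ENNReal.ofReal (Real.exp (-(v * t) ^ 2 / (2 * v))))
      (by simp [Real.exp_pos]) ENNReal.ofReal_ne_top).1 (ht.trans ?_)
    rw [← ENNReal.ofReal_mul (Real.exp_pos _).le, ← Real.exp_add]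
    congr 2
    field_simp
    ring
  rw [← withDensity_inv_same (measurable_gaussianPDF 0 v)
    (.of_forall fun x => (gaussianPDF_pos 0 hv x).ne') (.of_forall fun x => gaussianPDF_ne_top)
    (μ := ν), hρ, gaussianReal_of_var_ne_zero _ hv, ← withDensity_mul _ (by fun_prop) (by fun_prop)]
  congr 1
  ext x
  have hpos := gaussianPDFReal_pos 0 v x hv
  simp only [Pi.mul_apply, gaussianPDF]
  rw [← ENNReal.ofReal_inv_of_pos hpos, ← ENNReal.ofReal_mul (gaussianPDFReal_nonneg _ _ _)]
  congr 1
  rw [← div_eq_mul_inv, div_eq_iff hpos.ne']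
  simp only [gaussianPDFReal]
  rw [mul_left_comm, ← Real.exp_add]
  congr 2
  field_simp
  ring

open ProbabilityTheory in
theorem measurable_uncurry_gaussianPDF (v : NNReal) :
    Measurable fun p : ℝ × ℝ => gaussianPDF p.1 v p.2 := by
  unfold gaussianPDF gaussianPDFReal
  fun_prop

open ProbabilityTheory in
/-- A measure whose Gaussian smoothing integrates some nontrivial test function is s-finite. -/
theorem sFinite_of_lintegral_gaussian_ne_top {ν : Measure ℝ} {v : NNReal} (hv : v ≠ 0)
    {f : ℝ → ℝ} (hf : Continuous f) (hc : HasCompactSupport f) (h0 : ∀ x, 0 ≤ f x)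
    (hne : f ≠ 0)
    (h : ∫⁻ x, (∫⁻ y, ENNReal.ofReal (f y) * gaussianPDF x v y) ∂ν ≠ ⊤) : SFinite ν := by
  have heq : ∀ x, ∫⁻ y, ENNReal.ofReal (f y) * gaussianPDF x v y
      = ENNReal.ofReal (∫ y, f y * gaussianPDFReal x v y) := fun x => by
    rw [ofReal_integral_eq_lintegral_ofReal (integrable_mul_gaussianPDFReal hf hc x v)
      (.of_forall fun y => mul_nonneg (h0 y) (gaussianPDFReal_nonneg x v y))]
    simp_rw [gaussianPDF, ENNReal.ofReal_mul (h0 _)]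
  refine sFinite_of_lintegral_ne_top ?_ (fun x => ?_) (fun x => ?_) h
  · exact Measurable.lintegral_prod_right' (f := fun p : ℝ × ℝ =>
      ENNReal.ofReal (f p.2) * gaussianPDF p.1 v p.2)
      ((hf.measurable.comp measurable_snd).ennreal_ofReal.mul (measurable_uncurry_gaussianPDF v))
  · obtain ⟨y, hy⟩ := Function.ne_iff.1 hne
    rw [heq, ne_eq, ENNReal.ofReal_eq_zero, not_le]
    exact (hf.mul (continuous_gaussianPDFReal x v)).integral_pos_of_hasCompactSupport_nonneg_nonzero
      hc.mul_right (fun y => mul_nonneg (h0 y) (gaussianPDFReal_nonneg x v y))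
      (x := y) (mul_ne_zero hy (gaussianPDFReal_pos x v y hv).ne')
  · rw [heq]
    exact ENNReal.ofReal_ne_top

/-- Lemma 7.4: if a Borel measure `ν` on `ℝ` satisfies
`∫ ν(dh) E[f(h + N(0,σ²))] = ∫ e^{βh} f(h) dh` for all nonnegative `f ∈ C_c(ℝ)`,
then `ν(dh) = e^{-β²σ²/2 + βh} dh`. -/
theorem statement4 (σ β : ℝ) (hσ : 0 < σ) (ν : Measure ℝ)
    (hν : ∀ f : ℝ → ℝ, Continuous f → HasCompactSupport f → (∀ x, 0 ≤ f x) →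
      ∫⁻ h, ENNReal.ofReal (∫ x : ℝ,
          f (h + x) * ((Real.sqrt (2 * Real.pi * σ ^ 2))⁻¹ *
            Real.exp (-x ^ 2 / (2 * σ ^ 2)))) ∂ν
        = ∫⁻ h : ℝ, ENNReal.ofReal (Real.exp (β * h) * f h)) :
    ν = volume.withDensity fun h =>
      ENNReal.ofReal (Real.exp (-β ^ 2 * σ ^ 2 / 2 + β * h)) := by
  obtain ⟨v, hvσ⟩ : ∃ v : NNReal, (v : ℝ) = σ ^ 2 := ⟨⟨σ ^ 2, sq_nonneg σ⟩, rfl⟩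
  have hv : v ≠ 0 := by
    rintro rfl
    exact (pow_pos hσ 2).ne hvσ
  have hsmooth : ∀ f : ℝ → ℝ, Continuous f → HasCompactSupport f → (∀ x, 0 ≤ f x) →
      ∫⁻ h, (∫⁻ y, ENNReal.ofReal (f y) * ProbabilityTheory.gaussianPDF h v y) ∂ν
        = ∫⁻ h : ℝ, ENNReal.ofReal (Real.exp (β * h) * f h) := fun f hf hc h0 => by
    rw [← hν f hf hc h0]
    simp_rw [← ofReal_integral_add_mul_gaussianPDFReal hf hc h0, ProbabilityTheory.gaussianPDFReal,
      hvσ, sub_zero]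
  have hs : SFinite ν := by
    obtain ⟨f, hc, h0, hne⟩ := exists_continuous_nonneg_pos (0 : ℝ)
    refine sFinite_of_lintegral_gaussian_ne_top hv f.continuous hc h0
      (fun h => hne (congrFun h 0)) ?_
    rw [hsmooth f f.continuous hc h0]
    exact (Continuous.integrable_of_hasCompactSupport (by fun_prop)
      hc.mul_left).lintegral_lt_top.ne
  have hmeas := measurable_uncurry_gaussianPDF v
  have hG : Measurable fun y => ∫⁻ h, ProbabilityTheory.gaussianPDF h v y ∂ν :=
    hmeas.lintegral_prod_left'
  have hE : Measurable fun y => ENNReal.ofReal (Real.exp (β * y)) := by fun_prop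
  rw [← hvσ]
  refine eq_withDensity_exp_of_ae_lintegral_gaussianPDF hv β
    ((withDensity_eq_iff_of_sigmaFinite hG.aemeasurable hE.aemeasurable).1 ?_)
  have : IsLocallyFiniteMeasure
      (volume.withDensity fun y => ENNReal.ofReal (Real.exp (β * y))) :=
    IsLocallyFiniteMeasure.withDensity_ofReal (by fun_prop)
  refine ext_of_lintegral_hasCompactSupport fun f hf hc h0 => ?_
  have hfm : Measurable fun y => ENNReal.ofReal (f y) := hf.measurable.ennreal_ofReal
  rw [lintegral_withDensity_eq_lintegral_mul _ hG hfm,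
    lintegral_withDensity_eq_lintegral_mul _ hE hfm]
  simp only [Pi.mul_apply, ← ENNReal.ofReal_mul (Real.exp_pos _).le]
  rw [← hsmooth f hf hc h0, lintegral_lintegral_swap
    ((hfm.comp measurable_snd).mul hmeas).aemeasurable]
  refine lintegral_congr fun y => ?_
  rw [lintegral_const_mul _ hmeas.of_uncurry_right, mul_comm]
end
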